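/- Let S and T be dominant strings with S << T. Then for every integer n ≥ 1 the concatenated string S^n T is dominant. -/

import Mathlib

/-- The alternate lexicographic order `S << T` on strings (finite sequences of
positive integers, here 0-indexed lists): there is a first position where they differ,
and at that position (`k`-th entry, `k` 1-based) `S` is larger if `k` is odd and
smaller if `k` is even. -/
def StrLt (S T : List ℕ) : Prop :=
  ∃ j, j < S.length ∧ j < T.length ∧ (∀ i < j, S.getD i 0 = T.getD i 0) ∧
    (if j % 2 = 0 then T.getD j 0 < S.getD j 0 else S.getD j 0 < T.getD j 0)

/-- A string of even length is *dominant* if it is `<<`-smaller than each of its proper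
suffixes. -/
def Dominant (S : List ℕ) : Prop :=
  S.length % 2 = 0 ∧ ∀ X Y : List ℕ, S = X ++ Y → X ≠ [] → Y ≠ [] → StrLt S Y

theorem StrLt.trans {A B C : List ℕ} (h₁ : StrLt A B) (h₂ : StrLt B C) : StrLt A C := by
  obtain ⟨i, hiA, hiB, hi, hi'⟩ := h₁
  obtain ⟨j, hjB, hjC, hj, hj'⟩ := h₂
  rcases lt_trichotomy i j with h | rfl | h
  · refine ⟨i, hiA, by omega, fun k hk => (hi k hk).trans (hj k (by omega)), ?_⟩
    rwa [← hj i h]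
  · refine ⟨i, hiA, hjC, fun k hk => (hi k hk).trans (hj k hk), ?_⟩
    split_ifs at * <;> omega
  · refine ⟨j, by omega, hjC, fun k hk => (hi k (by omega)).trans (hj k hk), ?_⟩
    rwa [hi j h]

theorem StrLt.append {A B : List ℕ} (h : StrLt A B) (C D : List ℕ) :
    StrLt (A ++ C) (B ++ D) := by
  obtain ⟨j, hA, hB, hj, hj'⟩ := h
  refine ⟨j, by simp; omega, by simp; omega, fun i hi => ?_, ?_⟩
  · rw [List.getD_append _ _ _ _ (by omega), List.getD_append _ _ _ _ (by omega), hj i hi]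
  · rwa [List.getD_append _ _ _ _ hA, List.getD_append _ _ _ _ hB]

theorem StrLt.append_left {A B S : List ℕ} (hS : S.length % 2 = 0) (h : StrLt A B) :
    StrLt (S ++ A) (S ++ B) := by
  obtain ⟨j, hA, hB, hj, hj'⟩ := h
  refine ⟨S.length + j, by simp; omega, by simp; omega, fun i hi => ?_, ?_⟩
  · rcases lt_or_ge i S.length with hiS | hiS
    · rw [List.getD_append _ _ _ _ hiS, List.getD_append _ _ _ _ hiS]
    · rw [List.getD_append_right _ _ _ _ hiS, List.getD_append_right _ _ _ _ hiS,
        hj _ (by omega)]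
  · rw [List.getD_append_right _ _ _ _ (by omega), List.getD_append_right _ _ _ _ (by omega),
      Nat.add_sub_cancel_left, Nat.add_mod, hS, Nat.zero_add, Nat.mod_mod]
    exact hj'

theorem Dominant.append {S U : List ℕ} (hS : Dominant S) (hU : Dominant U)
    (h : StrLt (S ++ U) U) : Dominant (S ++ U) := by
  refine ⟨by rw [List.length_append, Nat.add_mod, hS.1, hU.1], fun X Y hXY hX hY => ?_⟩
  rcases List.append_eq_append_iff.1 hXY with ⟨W, rfl, hW⟩ | ⟨W, hW, rfl⟩
  · rcases eq_or_ne W [] with rfl | hW'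
    · simpa [hW] using h
    · exact h.trans (hU.2 W Y hW hW' hY)
  · rcases eq_or_ne W [] with rfl | hW'
    · simpa using h
    · exact (hS.2 X W hW hX hW').append U U

/-- If `S` and `T` are dominant strings with `S << T`, then for every
`n ≥ 1` the string `S^n T` is dominant. -/
theorem stmt_17 (S T : List ℕ) (hSpos : ∀ x ∈ S, 0 < x) (hTpos : ∀ x ∈ T, 0 < x)
    (hS : Dominant S) (hT : Dominant T) (hlt : StrLt S T) (n : ℕ) (hn : 1 ≤ n) :
    Dominant ((List.replicate n S).flatten ++ T) := by
  have key : ∀ m : ℕ, Dominant ((List.replicate m S).flatten ++ T) ∧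
      StrLt (S ++ ((List.replicate m S).flatten ++ T)) ((List.replicate m S).flatten ++ T) := by
    intro m
    induction m with
    | zero => exact ⟨by simpa using hT, by simpa using hlt.append T []⟩
    | succ m ih =>
      rw [List.replicate_succ, List.flatten_cons, List.append_assoc]
      exact ⟨hS.append ih.1 ih.2, ih.2.append_left hS.1⟩
  exact (key n).1
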